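/- Let m ≥ 3 and let u ∈ (ℤ[1/3, ω])^m be a vector with Σ_{j=1}^m |u_j|² = 1. Then there exists a finite sequence U_1, …, U_k of m×m matrices, each of which is either a 3-level matrix of type X, of type S, or of type H, or a 1-level matrix of type ω or of type −1, such that U_1 U_2 ⋯ U_k u = (1, 0, …, 0)^T. -/

import Mathlib

/-- `ω = e^{2πi/3}`. -/
noncomputable def ω : ℂ := Complex.exp (2 * Real.pi * Complex.I / 3)

/-- The qutrit gate `X`: the cyclic permutation matrix sending `e₁ ↦ e₂ ↦ e₃ ↦ e₁`. -/
def X3 : Matrix (Fin 3) (Fin 3) ℂ := !![0, 0, 1; 1, 0, 0; 0, 1, 0]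

/-- The qutrit gate `H = (1/(i√3))·[[1,1,1],[1,ω,ω²],[1,ω²,ω]]`. -/
noncomputable def H3 : Matrix (Fin 3) (Fin 3) ℂ :=
  (Complex.I * (Real.sqrt 3 : ℂ))⁻¹ • !![1, 1, 1; 1, ω, ω ^ 2; 1, ω ^ 2, ω]

/-- The qutrit gate `S = diag(1, 1, ω)`. -/
noncomputable def S3 : Matrix (Fin 3) (Fin 3) ℂ := !![1, 0, 0; 0, 1, 0; 0, 0, ω]

/-- The 1-level matrix `[a]_{[j]}` of type `a`: the identity matrix with its `(j,j)` entry
replaced by `a`. -/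
def IsOneLevel {m : ℕ} (a : ℂ) (M : Matrix (Fin m) (Fin m) ℂ) : Prop :=
  ∃ j : Fin m, M = Matrix.of fun i i' =>
    if i = i' then (if i = j then a else 1) else (0 : ℂ)

/-- `M` is a 3-level matrix of type `U ∈ M₃(ℂ)`: for some pairwise distinct indices
`j₁, j₂, j₃`, the `(j_r, j_s)` entry of `M` is `U_{r,s}`, the remaining diagonal entries are
`1`, and all other entries are `0`. -/
def IsThreeLevel {m : ℕ} (U : Matrix (Fin 3) (Fin 3) ℂ) (M : Matrix (Fin m) (Fin m) ℂ) : Prop :=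
  ∃ j : Fin 3 → Fin m, Function.Injective j ∧
    (∀ r s, M (j r) (j s) = U r s) ∧
    ∀ i i', ((¬ ∃ r, j r = i) ∨ (¬ ∃ s, j s = i')) → M i i' = if i = i' then 1 else 0

lemma omega_eq : ω = -1/2 + (Real.sqrt 3 / 2 : ℝ) * Complex.I := by
  have h : ω = Complex.exp (((Real.pi - Real.pi / 3 : ℝ) : ℂ) * Complex.I) := by
    unfold ω
    congr 1
    push_cast
    ring
  rw [h, Complex.exp_mul_I, ← Complex.ofReal_cos, ← Complex.ofReal_sin, Real.cos_pi_sub,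
    Real.sin_pi_sub, Real.cos_pi_div_three, Real.sin_pi_div_three]
  push_cast
  ring

lemma chi_eq : Complex.I * (Real.sqrt 3 : ℂ) = 1 + 2 * ω := by
  rw [omega_eq]; push_cast; ring

lemma sqrt3_sq : (Real.sqrt 3 : ℂ) ^ 2 = 3 := by
  rw [← Complex.ofReal_pow, Real.sq_sqrt (by norm_num)]; norm_num

lemma omega_quad : ω ^ 2 + ω + 1 = 0 := by
  rw [omega_eq]; push_cast
  linear_combination (1/4 : ℂ) * Complex.I ^ 2 * sqrt3_sq + (3/4 : ℂ) * Complex.I_sq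

lemma chi_sq : (1 + 2 * ω) ^ 2 = -3 := by
  linear_combination 4 * omega_quad

lemma chi_ne : (1 + 2 * ω) ≠ 0 := by
  intro h
  have := chi_sq
  rw [h] at this
  norm_num at this

lemma conj_omega : (starRingEnd ℂ) ω = -1 - ω := by
  rw [omega_eq]
  simp only [map_add, map_mul, map_div₀, map_neg, map_one, Complex.conj_ofReal, Complex.conj_I,
    map_ofNat]
  ring

lemma conj_chi : (1 + 2 * ω) * (starRingEnd ℂ) (1 + 2 * ω) = 3 := by
  simp only [map_add, map_mul, map_one, map_ofNat, conj_omega]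
  linear_combination -4 * omega_quad

lemma norm_pair (a b : ℤ) : ((a : ℂ) + b * ω) * (starRingEnd ℂ) ((a : ℂ) + b * ω)
    = ((a ^ 2 - a * b + b ^ 2 : ℤ) : ℂ) := by
  simp only [map_add, map_mul, conj_omega, map_intCast]
  push_cast
  linear_combination -(b : ℂ) ^ 2 * omega_quad

/-- Allowed gates. -/
def Good {m : ℕ} (M : Matrix (Fin m) (Fin m) ℂ) : Prop :=
  IsThreeLevel X3 M ∨ IsThreeLevel S3 M ∨ IsThreeLevel H3 M ∨
        IsOneLevel ω M ∨ IsOneLevel (-1) M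

/-- Reducible vectors. -/
def Reach {m : ℕ} (u : Fin m → ℂ) : Prop :=
  ∃ Us : List (Matrix (Fin m) (Fin m) ℂ), (∀ M ∈ Us, Good M) ∧
      Us.prod.mulVec u = fun i : Fin m => if (i : ℕ) = 0 then 1 else 0

lemma Reach.step {m : ℕ} {u : Fin m → ℂ} (M : Matrix (Fin m) (Fin m) ℂ) (hM : Good M)
    (h : Reach (M.mulVec u)) : Reach u := by
  obtain ⟨Us, h1, h2⟩ := h
  refine ⟨Us ++ [M], ?_, ?_⟩
  · intro N hN
    rcases List.mem_append.1 hN with h | h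
    · exact h1 N h
    · rw [List.mem_singleton.1 h]; exact hM
  · rw [List.prod_append, List.prod_singleton, ← Matrix.mulVec_mulVec, h2]

lemma Reach.one {m : ℕ} {u : Fin m → ℂ} (j : Fin m) (e : ℂ) (he : e = ω ∨ e = -1)
    (h : Reach (fun i => if i = j then e * u i else u i)) : Reach u := by
  refine Reach.step (Matrix.of fun i i' =>
    if i = i' then (if i = j then e else 1) else (0 : ℂ)) ?_ ?_
  · rcases he with rfl | rfl
    · exact Or.inr (Or.inr (Or.inr (Or.inl ⟨j, rfl⟩)))
    · exact Or.inr (Or.inr (Or.inr (Or.inr ⟨j, rfl⟩)))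
  · convert h using 1
    funext i
    simp [Matrix.mulVec, dotProduct, ite_mul]

lemma Reach.unit {m : ℕ} (j : Fin m) (e : ℂ) (he : e ∈ Submonoid.closure {ω, (-1 : ℂ)}) :
    ∀ u : Fin m → ℂ, Reach (fun i => if i = j then e * u i else u i) → Reach u := by
  induction he using Submonoid.closure_induction with
  | mem x hx => intro u h; exact Reach.one j x (by simpa using hx) h
  | one => intro u h; simpa using h
  | mul x y _ _ hx hy =>
    intro u h
    apply hy
    apply hx
    convert h using 1
    funext i
    split_ifs <;> ring

lemma Reach.units {m : ℕ} (e : Fin m → ℂ) (he : ∀ j, e j ∈ Submonoid.closure {ω, (-1 : ℂ)})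
    (u : Fin m → ℂ) (h : Reach (fun i => e i * u i)) : Reach u := by
  have key : ∀ s : Finset (Fin m), ∀ u : Fin m → ℂ,
      Reach (fun i => if i ∈ s then e i * u i else u i) → Reach u := by
    intro s
    induction s using Finset.induction_on with
    | empty => intro u h; simpa using h
    | insert j s hj ih =>
      intro u h
      apply ih
      apply Reach.unit j (e j) (he j)
      convert h using 1
      funext i
      by_cases hij : i = j
      · subst hij; simp [hj]
      · simp [hij]
  exact key Finset.univ u (by simpa using h)

lemma Reach.three {m : ℕ} (U : Matrix (Fin 3) (Fin 3) ℂ) (hU : U = X3 ∨ U = H3)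
    (j : Fin 3 → Fin m) (hj : Function.Injective j) (u u' : Fin m → ℂ)
    (h1 : ∀ r, u' (j r) = ∑ s, U r s * u (j s)) (h2 : ∀ i, (¬ ∃ r, j r = i) → u' i = u i)
    (h : Reach u') : Reach u := by
  classical
  let M : Matrix (Fin m) (Fin m) ℂ := Matrix.of fun i i' =>
    if (∃ r, j r = i) ∧ (∃ s, j s = i') then U (Function.invFun j i) (Function.invFun j i')
    else if i = i' then 1 else 0
  have hinv : ∀ r, Function.invFun j (j r) = r := Function.leftInverse_invFun hj
  have hM1 : ∀ r s, M (j r) (j s) = U r s := by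
    intro r s
    simp [M, hinv]
  have hM2 : ∀ i i', ((¬ ∃ r, j r = i) ∨ (¬ ∃ s, j s = i')) → M i i' = if i = i' then 1 else 0 := by
    intro i i' h
    simp only [M, Matrix.of_apply]
    rw [if_neg]
    tauto
  have hT : IsThreeLevel U M := ⟨j, hj, hM1, hM2⟩
  refine Reach.step M ?_ ?_
  · rcases hU with rfl | rfl
    · exact Or.inl hT
    · exact Or.inr (Or.inr (Or.inl hT))
  · convert h using 1
    funext i
    by_cases hi : ∃ r, j r = i
    · obtain ⟨r, rfl⟩ := hi
      rw [h1]
      symm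
      refine Fintype.sum_of_injective j hj _ _ ?_ ?_
      · intro i hi
        have hi' : ¬ ∃ s, j s = i := hi
        show M (j r) i * u i = 0
        rw [hM2 _ _ (Or.inr hi'), if_neg, zero_mul]
        intro h
        exact hi' ⟨r, h⟩
      · intro s
        show U r s * u (j s) = M (j r) (j s) * u (j s)
        rw [hM1]
    · rw [h2 i hi]
      simp only [Matrix.mulVec, dotProduct]
      rw [Finset.sum_congr rfl (fun i' _ => by rw [hM2 i i' (Or.inl hi)])]
      simp

/-- Norm form. -/
def N (a b : ℤ) : ℤ := a ^ 2 - a * b + b ^ 2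

lemma N_nonneg (a b : ℤ) : 0 ≤ N a b := by
  unfold N; nlinarith [sq_nonneg (a - b), sq_nonneg a, sq_nonneg b, sq_nonneg (a + b)]

lemma N_zero {a b : ℤ} (h : N a b = 0) : a = 0 ∧ b = 0 := by
  unfold N at h
  have h1 : a ^ 2 = 0 := by nlinarith [sq_nonneg (a - 2 * b), sq_nonneg a]
  have h2 : b ^ 2 = 0 := by nlinarith [sq_nonneg (b - 2 * a), sq_nonneg b]
  exact ⟨pow_eq_zero_iff (by norm_num) |>.1 h1, pow_eq_zero_iff (by norm_num) |>.1 h2⟩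

lemma N_mod (a b : ℤ) : N a b ≡ (if ¬ (3 ∣ a + b) then 1 else 0) [ZMOD 3] := by
  have h : N a b = (a + b) * (a + b) - 3 * (a * b) := by unfold N; ring
  have h3 : (a + b) % 3 = 0 ∨ (a + b) % 3 = 1 ∨ (a + b) % 3 = 2 := by omega
  rw [h, Int.ModEq, Int.sub_mul_emod_self_left, Int.mul_emod]
  rcases h3 with h | h | h
  · rw [if_neg (by omega), h]; rfl
  · rw [if_pos (by omega), h]; rfl
  · rw [if_pos (by omega), h]; rfl

lemma N_one {c d : ℤ} (h : N (1 + 3 * c) (3 * d) = 1) : c = 0 ∧ d = 0 := by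
  unfold N at h
  have h1 : -1 ≤ 3 * d := by nlinarith [sq_nonneg (2 * (1 + 3 * c) - 3 * d)]
  have h2 : 3 * d ≤ 1 := by nlinarith [sq_nonneg (2 * (1 + 3 * c) - 3 * d)]
  have hd : d = 0 := by omega
  subst hd
  have h4 : c * (3 * c + 2) = 0 := by nlinarith
  rcases mul_eq_zero.1 h4 with h | h
  · exact ⟨h, rfl⟩
  · omega

/-- Normalised pair. -/
def Nrm (a b : ℤ) : Prop := 3 ∣ a + b ∨ ∃ c d : ℤ, a = 1 + 3 * c ∧ b = 3 * d

lemma normalise (a b : ℤ) : ∃ e ∈ Submonoid.closure {ω, (-1 : ℂ)}, ∃ a' b' : ℤ,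
    e * ((a : ℂ) + b * ω) = a' + b' * ω ∧ N a' b' = N a b ∧ (3 ∣ a + b ↔ 3 ∣ a' + b') ∧ Nrm a' b' := by
  have hω : ω ∈ Submonoid.closure {ω, (-1 : ℂ)} := Submonoid.subset_closure (by simp)
  have hn : (-1 : ℂ) ∈ Submonoid.closure {ω, (-1 : ℂ)} := Submonoid.subset_closure (by simp)
  by_cases h : 3 ∣ a + b
  · exact ⟨1, one_mem _, a, b, by simp, rfl, Iff.rfl, Or.inl h⟩
  have pos : ∀ a b : ℤ, (a + b) % 3 = 1 → ∃ e ∈ Submonoid.closure {ω, (-1 : ℂ)}, ∃ a' b' : ℤ,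
    e * ((a : ℂ) + b * ω) = a' + b' * ω ∧ N a' b' = N a b ∧ (3 ∣ a + b ↔ 3 ∣ a' + b') ∧
      Nrm a' b' := by
    intro a b h
    have h3 : b % 3 = 0 ∨ b % 3 = 2 ∨ b % 3 = 1 := by omega
    rcases h3 with h3 | h3 | h3
    · exact ⟨1, one_mem _, a, b, by simp, rfl, Iff.rfl, Or.inr ⟨a / 3, b / 3, by omega, by omega⟩⟩
    · refine ⟨ω, hω, -b, a - b, ?_, by unfold N; ring, by omega,
        Or.inr ⟨(-b) / 3, (a - b) / 3, by omega, by omega⟩⟩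
      push_cast
      linear_combination (b : ℂ) * omega_quad
    · refine ⟨ω * ω, mul_mem hω hω, b - a, -a, ?_, by unfold N; ring, by omega,
        Or.inr ⟨(b - a) / 3, (-a) / 3, by omega, by omega⟩⟩
      push_cast
      linear_combination ((a : ℂ) + b * (ω - 1)) * omega_quad
  have h3 : (a + b) % 3 = 1 ∨ (a + b) % 3 = 2 := by omega
  rcases h3 with h3 | h3
  · exact pos a b h3
  · obtain ⟨e, he, a', b', h1, h2, h4, h5⟩ := pos (-a) (-b) (by omega)
    refine ⟨e * (-1), mul_mem he hn, a', b', ?_, ?_, by omega, h5⟩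
    · rw [← h1]; push_cast; ring
    · rw [h2]; unfold N; ring

lemma reach_basis {m : ℕ} (hm : 3 ≤ m) (j : Fin m) : Reach (fun i => if i = j then (1 : ℂ) else 0) := by
  have base : Reach (fun i => if i = (⟨0, by omega⟩ : Fin m) then (1 : ℂ) else 0) := by
    refine ⟨[], by simp, ?_⟩
    simp [Fin.ext_iff]
  by_cases hj : j = ⟨0, by omega⟩
  · rw [hj]; exact base
  obtain ⟨l, hl0, hlj⟩ : ∃ l : Fin m, l ≠ ⟨0, by omega⟩ ∧ l ≠ j := by
    by_cases h1 : j = ⟨1, by omega⟩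
    · exact ⟨⟨2, by omega⟩, by simp, by simp [h1]⟩
    · exact ⟨⟨1, by omega⟩, by simp, fun h => h1 h.symm⟩
  refine Reach.three X3 (Or.inl rfl) ![j, ⟨0, by omega⟩, l] ?_ _ _ ?_ ?_ base
  · intro r s
    fin_cases r <;> fin_cases s <;> simp [hj, hl0, hlj, Ne.symm hj, hl0.symm, hlj.symm, eq_comm]
  · intro r
    fin_cases r <;> simp [Fin.sum_univ_three, X3, hj, hl0, hlj, Ne.symm hj]
  · intro i hi
    have h1 : i ≠ j := fun h => hi ⟨0, by simp [h]⟩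
    have h2 : i ≠ ⟨0, by omega⟩ := fun h => hi ⟨1, by simp [h]⟩
    simp [h1, h2]

lemma card_mod {m : ℕ} (a b : Fin m → ℤ) :
    (∑ i, N (a i) (b i)) ≡ ((Finset.univ.filter fun i => ¬ (3 ∣ a i + b i)).card : ℤ) [ZMOD 3] := by
  rw [Finset.card_filter]
  push_cast
  exact Int.ModEq.sum fun i _ => N_mod _ _

lemma H_step {m : ℕ} (k : ℕ) (a b : Fin m → ℤ) (j : Fin 3 → Fin m) (hj : Function.Injective j)
    (c d : Fin 3 → ℤ) (ha : ∀ r, a (j r) = 1 + 3 * c r) (hb : ∀ r, b (j r) = 3 * d r) :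
    ∃ a' b' : Fin m → ℤ, (∑ i, N (a' i) (b' i)) = (∑ i, N (a i) (b i)) ∧
      (∀ r, 3 ∣ a' (j r) + b' (j r)) ∧ (∀ i, (¬ ∃ r, j r = i) → a' i = a i ∧ b' i = b i) ∧
      (Reach (fun i => ((a' i : ℂ) + b' i * ω) / (1 + 2 * ω) ^ k) →
        Reach (fun i => ((a i : ℂ) + b i * ω) / (1 + 2 * ω) ^ k)) := by
  let p : Fin 3 → ℤ := ![1 + c 0 + c 1 + c 2, c 0 - d 1 + d 2 - c 2, c 0 + d 1 - c 1 - d 2]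
  let q : Fin 3 → ℤ := ![d 0 + d 1 + d 2, d 0 + c 1 - d 1 - c 2, d 0 - c 1 + c 2 - d 2]
  let x : Fin 3 → ℤ := fun r => 2 * q r - p r
  let y : Fin 3 → ℤ := fun r => q r - 2 * p r
  have hxa : ∀ r, Function.extend j x a (j r) = x r := fun r => hj.extend_apply _ _ _
  have hyb : ∀ r, Function.extend j y b (j r) = y r := fun r => hj.extend_apply _ _ _
  have hxo : ∀ i, (¬ ∃ r, j r = i) → Function.extend j x a i = a i :=
    fun i hi => Function.extend_apply' _ _ _ hi
  have hyo : ∀ i, (¬ ∃ r, j r = i) → Function.extend j y b i = b i :=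
    fun i hi => Function.extend_apply' _ _ _ hi
  refine ⟨Function.extend j x a, Function.extend j y b, ?_, ?_, fun i hi => ⟨hxo i hi, hyo i hi⟩, ?_⟩
  · rw [← sub_eq_zero, ← Finset.sum_sub_distrib]
    rw [← Fintype.sum_of_injective j hj (fun r => N (x r) (y r) - N (1 + 3 * c r) (3 * d r))]
    · simp [Fin.sum_univ_three, x, y, p, q, N]
      ring
    · intro i hi
      rw [hxo i hi, hyo i hi, sub_self]
    · intro r
      rw [hxa, hyb, ha, hb]
  · intro r
    rw [hxa, hyb]
    exact ⟨q r - p r, by simp only [x, y]; ring⟩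
  · refine Reach.three H3 (Or.inr rfl) j hj _ _ ?_ ?_
    · intro r
      have hk := pow_ne_zero k chi_ne
      simp only [hxa, hyb, ha, hb]
      rw [H3, chi_eq]
      have hc := chi_ne
      simp only [Fin.sum_univ_three, Matrix.smul_apply, smul_eq_mul]
      rw [← mul_left_inj' hk, ← mul_right_inj' hc]
      have hq := omega_quad
      generalize hX : (1 + 2 * ω) ^ k = X at *
      fin_cases r <;> simp [x, y, p, q] <;> field_simp <;> grind
    · intro i hi
      simp only [hxo i hi, hyo i hi]

lemma chi_div {a b : ℤ} (h : 3 ∣ a + b) : ∃ c d : ℤ, (a : ℂ) + b * ω = (1 + 2 * ω) * (c + d * ω) ∧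
    N a b = 3 * N c d := by
  obtain ⟨t, ht⟩ := h
  have hb : b = 3 * t - a := by omega
  refine ⟨2 * t - a, t - a, ?_, ?_⟩
  · subst hb; push_cast
    linear_combination (-2 * ((t : ℂ) - a)) * omega_quad
  · subst hb; unfold N; ring

lemma main_red {m : ℕ} (hm : 3 ≤ m) (k : ℕ) : ∀ n : ℕ, ∀ a b : Fin m → ℤ,
    (∑ i, N (a i) (b i)) = 3 ^ k →
    (Finset.univ.filter fun i => ¬ (3 ∣ a i + b i)).card = n →
    Reach (fun i => ((a i : ℂ) + b i * ω) / (1 + 2 * ω) ^ k) := by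
  induction k with
  | zero =>
    intro n a0 b0 hs0 _
    choose e he a b hab hN _ hnrm using fun i => normalise (a0 i) (b0 i)
    have hs : (∑ i, N (a i) (b i)) = 1 := by rw [Finset.sum_congr rfl fun i _ => hN i, hs0]; rfl
    apply Reach.units e he
    obtain ⟨j, hj⟩ : ∃ j, N (a j) (b j) ≠ 0 := by
      by_contra! h
      simp [h] at hs
    have hsum := Finset.add_sum_erase Finset.univ (fun i => N (a i) (b i)) (Finset.mem_univ j)
    have h0 : 0 ≤ ∑ i ∈ Finset.univ.erase j, N (a i) (b i) :=
      Finset.sum_nonneg fun i _ => N_nonneg _ _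
    have hjn := N_nonneg (a j) (b j)
    simp only [hs] at hsum
    have hj1 : N (a j) (b j) = 1 := by omega
    have hr : ∑ i ∈ Finset.univ.erase j, N (a i) (b i) = 0 := by omega
    rw [Finset.sum_eq_zero_iff_of_nonneg fun i _ => N_nonneg _ _] at hr
    convert reach_basis hm j using 1
    funext i
    rw [mul_div_assoc', hab]
    by_cases hij : i = j
    · subst hij
      rcases hnrm i with h | ⟨c, d, h1, h2⟩
      · have := N_mod (a i) (b i)
        rw [if_neg (by simpa using h), hj1] at this
        exact absurd this (by decide)
      · rw [h1, h2] at hj1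
        obtain ⟨rfl, rfl⟩ := N_one hj1
        simp [h1, h2]
    · obtain ⟨h1, h2⟩ := N_zero (hr i (by simp [hij]))
      simp [h1, h2, hij]
  | succ k ihk =>
    intro n
    induction n using Nat.strong_induction_on with
    | _ n ih =>
    intro a0 b0 hs0 hn0
    choose e he a b hab hN hdiv hnrm using fun i => normalise (a0 i) (b0 i)
    have hs : (∑ i, N (a i) (b i)) = 3 ^ (k + 1) := by rw [Finset.sum_congr rfl fun i _ => hN i, hs0]
    have hn : (Finset.univ.filter fun i => ¬ (3 ∣ a i + b i)).card = n := by
      rw [← hn0]; congr 1; ext i; simp [hdiv i]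
    apply Reach.units e he
    have hfun : (fun i => e i * (((a0 i : ℂ) + b0 i * ω) / (1 + 2 * ω) ^ (k + 1)))
        = (fun i => ((a i : ℂ) + b i * ω) / (1 + 2 * ω) ^ (k + 1)) := by
      funext i; rw [mul_div_assoc', hab]
    rw [hfun]
    by_cases hz : n = 0
    · rw [hz, Finset.card_eq_zero, Finset.filter_eq_empty_iff] at hn
      have hd : ∀ i, 3 ∣ a i + b i := fun i => by simpa using hn (Finset.mem_univ i)
      choose c d hcd hNcd using fun i => chi_div (hd i)
      have := ihk _ c d (by
        rw [Finset.sum_congr rfl fun i _ => hNcd i, ← Finset.mul_sum, pow_succ] at hs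
        omega) rfl
      convert this using 1
      funext i
      rw [hcd, pow_succ', mul_div_mul_left _ _ chi_ne]
    · have hmod := card_mod a b
      rw [hs, hn] at hmod
      have h3 : 2 < n := by
        have : (3 : ℤ) ^ (k + 1) % 3 = 0 := by rw [pow_succ]; simp
        unfold Int.ModEq at hmod
        omega
      rw [← hn, Finset.two_lt_card] at h3
      obtain ⟨j0, h0, j1, h1, j2, h2, h01, h02, h12⟩ := h3
      simp only [Finset.mem_filter, Finset.mem_univ, true_and] at h0 h1 h2
      let j : Fin 3 → Fin m := ![j0, j1, j2]
      have hj : Function.Injective j := by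
        intro r s
        fin_cases r <;> fin_cases s <;> simp [j, h01, h02, h12, h01.symm, h02.symm, h12.symm]
      have hjd : ∀ r, ¬ 3 ∣ a (j r) + b (j r) := by
        intro r; fin_cases r <;> simpa [j]
      choose c d hc hd using fun r => (hnrm (j r)).resolve_left (hjd r)
      obtain ⟨a', b', hs', hdv, hout, himp⟩ := H_step (k + 1) a b j hj c d hc hd
      apply himp
      refine ih _ ?_ a' b' (hs'.trans hs) rfl
      rw [← hn]
      apply Finset.card_lt_card
      rw [Finset.ssubset_iff_of_subset]
      · exact ⟨j0, by simpa using h0, by simpa [j] using hdv 0⟩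
      · intro i hi
        simp only [Finset.mem_filter, Finset.mem_univ, true_and] at hi ⊢
        by_cases hr : ∃ r, j r = i
        · obtain ⟨r, rfl⟩ := hr
          exact absurd (hdv r) hi
        · rw [← (hout i hr).1, ← (hout i hr).2]; exact hi

lemma denom {z : ℂ} (hz : z ∈ Subring.closure {(3 : ℂ)⁻¹, ω}) :
    ∃ K : ℕ, ∀ k, K ≤ k → ∃ a b : ℤ, z * (1 + 2 * ω) ^ k = a + b * ω := by
  have mulE : ∀ a b c d : ℤ, ∃ x y : ℤ, ((a : ℂ) + b * ω) * (c + d * ω) = x + y * ω := by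
    intro a b c d
    refine ⟨a * c - b * d, a * d + b * c - b * d, ?_⟩
    push_cast
    linear_combination (b * d : ℂ) * omega_quad
  have powE : ∀ k : ℕ, ∃ a b : ℤ, (1 + 2 * ω) ^ k = a + b * ω := by
    intro k
    induction k with
    | zero => exact ⟨1, 0, by simp⟩
    | succ k ih =>
      obtain ⟨a, b, h⟩ := ih
      obtain ⟨x, y, h'⟩ := mulE a b 1 2
      exact ⟨x, y, by rw [pow_succ, h, ← h']; push_cast; ring⟩
  induction hz using Subring.closure_induction with
  | mem x hx =>
    rcases hx with rfl | rfl
    · refine ⟨2, fun k hk => ?_⟩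
      obtain ⟨l, rfl⟩ := Nat.exists_eq_add_of_le hk
      obtain ⟨a, b, h⟩ := powE l
      refine ⟨-a, -b, ?_⟩
      rw [pow_add, chi_sq, h]; push_cast; ring
    · refine ⟨0, fun k _ => ?_⟩
      obtain ⟨a, b, h⟩ := powE k
      obtain ⟨x, y, h'⟩ := mulE 0 1 a b
      exact ⟨x, y, by rw [h, ← h']; push_cast; ring⟩
  | zero => exact ⟨0, fun k _ => ⟨0, 0, by simp⟩⟩
  | one => exact ⟨0, fun k _ => by simpa using powE k⟩
  | add x y _ _ hx hy =>
    obtain ⟨K, hK⟩ := hx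
    obtain ⟨L, hL⟩ := hy
    refine ⟨K + L, fun k hk => ?_⟩
    obtain ⟨a, b, h⟩ := hK k (by omega)
    obtain ⟨c, d, h'⟩ := hL k (by omega)
    refine ⟨a + c, b + d, ?_⟩
    rw [add_mul, h, h']; push_cast; ring
  | neg x _ hx =>
    obtain ⟨K, hK⟩ := hx
    refine ⟨K, fun k hk => ?_⟩
    obtain ⟨a, b, h⟩ := hK k hk
    refine ⟨-a, -b, ?_⟩
    rw [neg_mul, h]; push_cast; ring
  | mul x y _ _ hx hy =>
    obtain ⟨K, hK⟩ := hx
    obtain ⟨L, hL⟩ := hy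
    refine ⟨K + L, fun k hk => ?_⟩
    obtain ⟨l, rfl⟩ := Nat.exists_eq_add_of_le hk
    obtain ⟨a, b, h⟩ := hK K le_rfl
    obtain ⟨c, d, h'⟩ := hL (L + l) (by omega)
    obtain ⟨x', y', h''⟩ := mulE a b c d
    refine ⟨x', y', ?_⟩
    rw [← h'', ← h, ← h']; ring

/-- For `m ≥ 3` and a unit vector `u ∈ (ℤ[1/3, ω])^m`, there is a finite
sequence of `m×m` matrices, each a 3-level matrix of type `X`, `S` or `H`, or a 1-level matrix
of type `ω` or `−1`, whose product maps `u` to `(1, 0, …, 0)ᵀ`. -/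
theorem column_reduction
    (m : ℕ) (hm : 3 ≤ m)
    (u : Fin m → ℂ) (hu : ∀ j, u j ∈ Subring.closure {(3 : ℂ)⁻¹, ω})
    (hnorm : ∑ j, u j * (starRingEnd ℂ) (u j) = 1) :
    ∃ Us : List (Matrix (Fin m) (Fin m) ℂ),
      (∀ M ∈ Us, IsThreeLevel X3 M ∨ IsThreeLevel S3 M ∨ IsThreeLevel H3 M ∨
        IsOneLevel ω M ∨ IsOneLevel (-1) M) ∧
      Us.prod.mulVec u = fun i : Fin m => if (i : ℕ) = 0 then 1 else 0 := by
  choose K hK using fun j => denom (hu j)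
  let k := Finset.univ.sup K
  choose a b hab using fun j => hK j k (Finset.le_sup (Finset.mem_univ j))
  have hk := pow_ne_zero k chi_ne
  have hu' : u = fun i => ((a i : ℂ) + b i * ω) / (1 + 2 * ω) ^ k := by
    funext i
    rw [← hab, mul_div_cancel_right₀ _ hk]
  have hs : (∑ i, N (a i) (b i)) = 3 ^ k := by
    have : ((∑ i, N (a i) (b i) : ℤ) : ℂ) = ((3 ^ k : ℤ) : ℂ) := by
      push_cast
      rw [← conj_chi, mul_pow]
      refine Eq.trans ?_ (one_mul ((1 + 2 * ω) ^ k * (starRingEnd ℂ) (1 + 2 * ω) ^ k))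
      refine Eq.trans ?_ (congrArg (· * ((1 + 2 * ω) ^ k * (starRingEnd ℂ) (1 + 2 * ω) ^ k)) hnorm)
      simp only [Finset.sum_mul]
      refine Finset.sum_congr rfl fun i _ => ?_
      unfold N
      rw [← norm_pair, ← hab, map_mul, map_pow]
      ring
    exact_mod_cast this
  have := main_red hm k _ a b hs rfl
  rw [← hu'] at this
  exact this
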